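/- Let n be a finite index type. The set of matrices M : Matrix n n ℂ such that every eigenvalue λ ∈ spectrum ℂ M satisfies Re λ < 0 is an open subset of Matrix n n ℂ. -/

import Mathlib

/-- Upper hemicontinuity of the spectrum: the elements of a Banach algebra whose spectrum lies in
a given open set form an open set. -/
theorem isOpen_setOf_spectrum_subset {𝕜 A : Type*} [NormedField 𝕜] [ProperSpace 𝕜]
    [NormedRing A] [NormedAlgebra 𝕜 A] [CompleteSpace A] {U : Set 𝕜} (hU : IsOpen U) :
    IsOpen {a : A | spectrum 𝕜 a ⊆ U} :=
  upperHemicontinuous_iff_isOpen_preimage_Iic.mp (upperHemicontinuous_spectrum 𝕜 A) U hU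

/-- The set of Hurwitz matrices (complex square matrices all of whose eigenvalues have
negative real part) is open in `Matrix n n ℂ`. -/
theorem isOpen_hurwitz_matrices {n : Type*} [Fintype n] [DecidableEq n] :
    IsOpen {M : Matrix n n ℂ | ∀ lam ∈ spectrum ℂ M, lam.re < 0} := by
  let : NormedRing (Matrix n n ℂ) := Matrix.linftyOpNormedRing
  let : NormedAlgebra ℂ (Matrix n n ℂ) := Matrix.linftyOpNormedAlgebra
  have : CompleteSpace (Matrix n n ℂ) := FiniteDimensional.complete ℂ _
  exact isOpen_setOf_spectrum_subset (isOpen_lt Complex.continuous_re continuous_const)
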